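/- Let X be a countable commutative additive monoid, d, k ≥ 1 integers, p_{j,r} ∈ ℝ for j ∈ {1,…,k}, r ∈ {1,…,d}, λ_r ∈ (0,∞), U_r probability mass functions in ℓ¹(X), W_r = U_r − δ₀, R_j = Σ_{r=1}^d p_{j,r} W_r, G = exp(Σ_{r=1}^d λ_r W_r), and p_j = Σ_{r=1}^d |p_{j,r}|. Set c_k = ((2k)!)^{1/(2k)} and c_k' = ((2k−1)!)^{1/(4k)}. Then for all u ∈ [0,1/2]^k and v, w ∈ (0,∞)^k: ‖ (∏_{j=1}^k R_j^{*2}) * G ‖ ≤ ∏_{j=1}^k ( C_j · Σ_{r=1}^d |p_{j,r}| · min{ |p_{j,r}|/λ_r, (4/w_j)·p_j } ), where C_j = max{ c_k + c_k'·u_j/v_j, (2(1−u_j) + c_k'·u_j·v_j)·w_j }. -/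

import Mathlib

open scoped Classical BigOperators

noncomputable section

namespace PaperL1

variable {X : Type*} [AddCommMonoid X]

/-- Convolution of two summable functions on an additive commutative monoid:
`(f ⋆ g) x = Σ_{(y,z) : y + z = x} f y * g z`. -/
def conv (f g : X → ℝ) : X → ℝ :=
  fun x => ∑' p : {p : X × X // p.1 + p.2 = x}, f p.1.1 * g p.1.2

/-- The Dirac delta at a point: the unit of the convolution algebra is `delta 0`. -/
def delta (x₀ : X) : X → ℝ := fun x => if x = x₀ then 1 else 0

/-- Convolution powers, with `f^{*0} = δ₀`. -/
def convPow (f : X → ℝ) : ℕ → (X → ℝ)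
  | 0 => delta 0
  | n + 1 => conv f (convPow f n)

/-- The exponential in the convolution algebra: `exp f = Σ_m f^{*m}/m!`. -/
def convExp (f : X → ℝ) : X → ℝ :=
  fun x => ∑' m : ℕ, ((m.factorial : ℝ))⁻¹ * convPow f m x

/-- Convolution product over a finite (linearly ordered) index set; the empty
product is `δ₀`. -/
def convProd {ι : Type*} [LinearOrder ι] (s : Finset ι) (f : ι → X → ℝ) : X → ℝ :=
  (s.sort (· ≤ ·)).foldr (fun i acc => conv (f i) acc) (delta 0)

/-- The ℓ¹ norm: `‖f‖ = Σ_x |f x|`. -/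
def l1norm (f : X → ℝ) : ℝ := ∑' x, |f x|

/-- A probability mass function: nonnegative values summing to `1`. -/
def IsPmf (f : X → ℝ) : Prop := (∀ x, 0 ≤ f x) ∧ HasSum f 1

/-- The function `g(x) = 2 Σ_{m=2}^∞ (m-1) x^{m-2} / m!`. -/
def gfun (x : ℝ) : ℝ := ∑' m : ℕ, 2 * (m + 1) * x ^ m / ((m + 2).factorial : ℝ)

end PaperL1

open PaperL1

namespace PaperL1

/-! ### Poisson calculus on `Fin d → ℕ` -/

/-- Unit vector. -/
def ee {d : ℕ} (r : Fin d) : Fin d → ℕ := fun s => if s = r then 1 else 0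

/-- Product Poisson weights. -/
def poi {d : ℕ} (lam : Fin d → ℝ) (n : Fin d → ℕ) : ℝ :=
  ∏ r, (Real.exp (-lam r) * (lam r ^ n r / (n r).factorial))

/-- Functions of at most exponential growth. -/
def Good {d : ℕ} {E : Type*} [NormedAddCommGroup E] (H : (Fin d → ℕ) → E) : Prop :=
  ∃ C K : ℝ, 0 ≤ C ∧ 1 ≤ K ∧ ∀ n, ‖H n‖ ≤ C * K ^ (∑ r, n r)

/-- Poisson expectation. -/
def EE {d : ℕ} (lam : Fin d → ℝ) {E : Type*} [NormedAddCommGroup E] [NormedSpace ℝ E]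
    (H : (Fin d → ℕ) → E) : E := ∑' n, poi lam n • H n

lemma poi_nonneg {d : ℕ} {lam : Fin d → ℝ} (hlam : ∀ r, 0 < lam r) (n : Fin d → ℕ) :
    0 ≤ poi lam n := by
  unfold poi
  exact Finset.prod_nonneg fun r _ => by have := hlam r; positivity

lemma pi_tsum {A : Type*} [NormedCommRing A] [CompleteSpace A] : ∀ {d : ℕ}
    (f : Fin d → ℕ → A) (_ : ∀ r, Summable fun n => ‖f r n‖),
    (Summable fun n : Fin d → ℕ => ‖∏ r, f r (n r)‖) ∧
      ∑' n : Fin d → ℕ, ∏ r, f r (n r) = ∏ r, ∑' m, f r m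
  | 0, f, _ => by
      constructor
      · exact Summable.of_finite
      · simp
  | d + 1, f, hf => by
      obtain ⟨h1, h2⟩ := pi_tsum (fun r => f r.succ) (fun r => hf r.succ)
      have e := Fin.consEquiv (fun _ : Fin (d+1) => ℕ)
      constructor
      · rw [← (Fin.consEquiv (fun _ : Fin (d+1) => ℕ)).summable_iff]
        have := Summable.mul_norm (hf 0) h1
        refine this.congr fun x => ?_
        simp [Fin.prod_univ_succ, Fin.consEquiv]
      · rw [← (Fin.consEquiv (fun _ : Fin (d+1) => ℕ)).tsum_eq, Fin.prod_univ_succ, ← h2,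
          tsum_mul_tsum_of_summable_norm (hf 0) h1]
        refine tsum_congr fun x => ?_
        simp [Fin.prod_univ_succ, Fin.consEquiv]

set_option linter.unusedSectionVars false

section good
variable {d : ℕ} {E : Type*} [NormedAddCommGroup E] [NormedSpace ℝ E]

lemma Good.add {f g : (Fin d → ℕ) → E} (hf : Good f) (hg : Good g) :
    Good (fun n => f n + g n) := by
  obtain ⟨C, K, hC, hK, h⟩ := hf
  obtain ⟨C', K', hC', hK', h'⟩ := hg
  refine ⟨C + C', max K K', by positivity, le_max_of_le_left hK, fun n => ?_⟩
  calc ‖f n + g n‖ ≤ C * K ^ (∑ r, n r) + C' * K' ^ (∑ r, n r) :=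
        (norm_add_le _ _).trans (add_le_add (h n) (h' n))
    _ ≤ C * (max K K') ^ (∑ r, n r) + C' * (max K K') ^ (∑ r, n r) := by
        gcongr
        · exact le_max_left _ _
        · exact le_max_right _ _
    _ = _ := by ring

lemma Good.smul {f : (Fin d → ℕ) → ℝ} {g : (Fin d → ℕ) → E} (hf : Good f) (hg : Good g) :
    Good (fun n => f n • g n) := by
  obtain ⟨C, K, hC, hK, h⟩ := hf
  obtain ⟨C', K', hC', hK', h'⟩ := hg
  refine ⟨C * C', K * K', by positivity, one_le_mul_of_one_le_of_one_le hK hK', fun n => ?_⟩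
  rw [norm_smul, mul_pow]
  calc ‖f n‖ * ‖g n‖ ≤ (C * K ^ (∑ r, n r)) * (C' * K' ^ (∑ r, n r)) := by
        gcongr
        · exact h n
        · exact h' n
    _ = _ := by ring

lemma Good.mul {f g : (Fin d → ℕ) → ℝ} (hf : Good f) (hg : Good g) :
    Good (fun n => f n * g n) := Good.smul hf hg

lemma good_of_bdd {f : (Fin d → ℕ) → E} (C : ℝ) (h : ∀ n, ‖f n‖ ≤ C) : Good f :=
  ⟨C, 1, (norm_nonneg _).trans (h 0), le_rfl, fun n => by simpa using h n⟩

lemma good_const (c : E) : Good (fun _ : Fin d → ℕ => c) := good_of_bdd ‖c‖ fun _ => le_rfl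

lemma Good.neg {f : (Fin d → ℕ) → E} (hf : Good f) : Good (fun n => - f n) := by
  simpa [Good] using hf

lemma Good.sub {f g : (Fin d → ℕ) → E} (hf : Good f) (hg : Good g) :
    Good (fun n => f n - g n) := by
  simpa [sub_eq_add_neg] using hf.add hg.neg

lemma Good.sum {ι : Type*} (s : Finset ι) {f : ι → (Fin d → ℕ) → E} (hf : ∀ i, Good (f i)) :
    Good (fun n => ∑ i ∈ s, f i n) := by
  induction s using Finset.induction_on with
  | empty => simpa using good_const (0 : E)
  | insert a s ha ih => simpa [Finset.sum_insert ha] using (hf a).add ih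

lemma good_coord (r : Fin d) : Good (fun n : Fin d → ℕ => (n r : ℝ)) := by
  refine ⟨1, 2, by norm_num, by norm_num, fun n => ?_⟩
  have h1 : n r ≤ ∑ r, n r := Finset.single_le_sum (fun _ _ => Nat.zero_le _) (Finset.mem_univ r)
  have h2 : n r ≤ 2 ^ (∑ r, n r) := h1.trans (Nat.lt_two_pow_self).le
  simp only [Real.norm_natCast, one_mul]
  exact_mod_cast h2

lemma Good.up {f : (Fin d → ℕ) → E} (hf : Good f) (r : Fin d) : Good (fun n => f (n + ee r)) := by
  obtain ⟨C, K, hC, hK, h⟩ := hf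
  refine ⟨C * K, K, by positivity, hK, fun n => ?_⟩
  refine (h _).trans (le_of_eq ?_)
  simp [Finset.sum_add_distrib, ee, pow_succ]
  ring

lemma Good.down {f : (Fin d → ℕ) → E} (hf : Good f) (r : Fin d) : Good (fun n => f (n - ee r)) := by
  obtain ⟨C, K, hC, hK, h⟩ := hf
  refine ⟨C, K, by positivity, hK, fun n => ?_⟩
  refine (h _).trans ?_
  gcongr with i
  simp

variable {lam : Fin d → ℝ} (hlam : ∀ r, 0 < lam r)
include hlam

lemma poi_summable (K : ℝ) : Summable fun n : Fin d → ℕ => poi lam n * K ^ (∑ r, n r) := by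
  have := (pi_tsum (fun (r : Fin d) (m : ℕ) => Real.exp (-lam r) * (lam r ^ m / m.factorial) * K ^ m)
    (fun r => ?_)).1.of_norm
  · refine this.congr fun n => ?_
    rw [Finset.prod_mul_distrib, poi, Finset.prod_pow_eq_pow_sum]
  · have := (((Real.summable_pow_div_factorial (lam r * K)).norm).mul_left (Real.exp (-lam r)))
    refine this.congr fun m => ?_
    simp [mul_pow]
    ring

lemma Good.summable_norm {f : (Fin d → ℕ) → E} (hf : Good f) :
    Summable fun n => ‖poi lam n • f n‖ := by
  obtain ⟨C, K, hC, hK, h⟩ := hf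
  refine Summable.of_nonneg_of_le (fun _ => norm_nonneg _) (fun n => ?_)
    ((poi_summable hlam K).mul_left C)
  rw [norm_smul, Real.norm_of_nonneg (poi_nonneg hlam n)]
  calc _ ≤ poi lam n * (C * K ^ (∑ r, n r)) := by
        have := poi_nonneg hlam n
        gcongr
        exact h n
    _ = _ := by ring

variable [CompleteSpace E]

lemma Good.summable {f : (Fin d → ℕ) → E} (hf : Good f) :
    Summable fun n => poi lam n • f n := (hf.summable_norm hlam).of_norm

lemma EE_add {f g : (Fin d → ℕ) → E} (hf : Good f) (hg : Good g) :
    EE lam (fun n => f n + g n) = EE lam f + EE lam g := by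
  simp only [EE, smul_add]
  exact (hf.summable hlam).tsum_add (hg.summable hlam)

lemma EE_sub {f g : (Fin d → ℕ) → E} (hf : Good f) (hg : Good g) :
    EE lam (fun n => f n - g n) = EE lam f - EE lam g := by
  simp only [EE, smul_sub]
  exact (hf.summable hlam).tsum_sub (hg.summable hlam)

omit hlam [CompleteSpace E] in
lemma EE_smul (c : ℝ) (f : (Fin d → ℕ) → E) :
    EE lam (fun n => c • f n) = c • EE lam f := by
  simp only [EE, smul_comm _ c]
  exact tsum_const_smul'' c

lemma EE_sum {ι : Type*} (s : Finset ι) {f : ι → (Fin d → ℕ) → E} (hf : ∀ i, Good (f i)) :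
    EE lam (fun n => ∑ i ∈ s, f i n) = ∑ i ∈ s, EE lam (f i) := by
  simp only [EE, Finset.smul_sum]
  exact Summable.tsum_finsetSum fun i _ => (hf i).summable hlam

omit [CompleteSpace E] in
lemma EE_norm_le {f : (Fin d → ℕ) → E} (hf : Good f) : ‖EE lam f‖ ≤ EE lam (fun n => ‖f n‖) := by
  refine (norm_tsum_le_tsum_norm (hf.summable_norm hlam)).trans (le_of_eq ?_)
  refine tsum_congr fun n => ?_
  rw [norm_smul, Real.norm_of_nonneg (poi_nonneg hlam n), smul_eq_mul]

omit [NormedSpace ℝ E] [CompleteSpace E] in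
lemma EE_mono {f g : (Fin d → ℕ) → ℝ} (hf : Good f) (hg : Good g) (h : ∀ n, f n ≤ g n) :
    EE lam f ≤ EE lam g := by
  refine (hf.summable hlam).tsum_le_tsum (fun n => ?_) (hg.summable hlam)
  exact mul_le_mul_of_nonneg_left (h n) (poi_nonneg hlam n)

omit [CompleteSpace E] in
lemma poi_shift (r : Fin d) (n : Fin d → ℕ) :
    poi lam (n + ee r) * ((n r + 1 : ℝ) / lam r) = poi lam n := by
  have hr := (hlam r).ne'
  unfold poi
  rw [← Finset.mul_prod_erase _ _ (Finset.mem_univ r), ← Finset.mul_prod_erase _ _ (Finset.mem_univ r)]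
  have : ∏ x ∈ Finset.univ.erase r, Real.exp (-lam x) * (lam x ^ (n + ee r) x / ((n + ee r) x).factorial)
      = ∏ x ∈ Finset.univ.erase r, Real.exp (-lam x) * (lam x ^ n x / (n x).factorial) := by
    refine Finset.prod_congr rfl fun x hx => ?_
    simp [ee, Finset.ne_of_mem_erase hx]
  rw [this]
  have h2 : (n + ee r) r = n r + 1 := by simp [ee]
  rw [h2, Nat.factorial_succ, pow_succ]
  push_cast
  field_simp

omit [CompleteSpace E] in
/-- Mecke identity. -/
lemma mecke (r : Fin d) (H : (Fin d → ℕ) → E) :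
    EE lam (fun n => ((n r : ℝ) / lam r) • H n) = EE lam (fun n => H (n + ee r)) := by
  unfold EE
  have hinj : Function.Injective (fun n : Fin d → ℕ => n + ee r) := fun a b h => add_right_cancel h
  rw [← hinj.tsum_eq]
  · refine tsum_congr fun n => ?_
    rw [← poi_shift hlam r n, smul_smul]
    simp [ee]
  · intro n hn
    refine ⟨n - ee r, ?_⟩
    have : n r ≠ 0 := by
      intro h0; apply hn; simp [h0]
    funext s
    by_cases h : s = r
    · subst h; simp [ee]; omega
    · simp [ee, h]

end good
end PaperL1

namespace PaperL1

section ccr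
variable {d : ℕ}

/-- Annihilation operator. -/
def Dn (r : Fin d) : Module.End ℝ ((Fin d → ℕ) → ℝ) where
  toFun f := fun n => f (n + ee r) - f n
  map_add' f g := by funext n; simp; ring
  map_smul' c f := by funext n; simp; ring

/-- Creation operator. -/
def Up (lam : Fin d → ℝ) (r : Fin d) : Module.End ℝ ((Fin d → ℕ) → ℝ) where
  toFun f := fun n => (n r / lam r) * f (n - ee r) - f n
  map_add' f g := by funext n; simp; ring
  map_smul' c f := by funext n; simp; ring

lemma ee_ne {r s : Fin d} (h : s ≠ r) : ee r s = 0 := by simp [ee, h]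
lemma ee_self (r : Fin d) : ee r r = 1 := by simp [ee]

lemma sub_add_ee (r : Fin d) (n : Fin d → ℕ) (h : n r ≠ 0) : n - ee r + ee r = n := by
  funext s
  by_cases h : s = r
  · subst h; simp [ee]; omega
  · simp [ee, h]

lemma sub_add_ee' {r s : Fin d} (hrs : r ≠ s) (n : Fin d → ℕ) :
    n + ee r - ee s = n - ee s + ee r := by
  funext t
  by_cases h : t = s
  · subst h; simp [ee, hrs.symm]
  · simp [ee, h]

lemma ccr_self {lam : Fin d → ℝ} (hlam : ∀ r, 0 < lam r) (r : Fin d) :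
    Dn r * Up lam r = Up lam r * Dn r + (lam r)⁻¹ • 1 := by
  ext f n
  have hr := (hlam r).ne'
  simp only [Module.End.mul_apply, LinearMap.add_apply, LinearMap.smul_apply, Module.End.one_apply,
    Dn, Up, LinearMap.coe_mk, AddHom.coe_mk, Pi.add_apply, Pi.smul_apply, smul_eq_mul, ee_self,
    add_tsub_cancel_right]
  by_cases h : n r = 0
  · simp [h]; ring
  · rw [sub_add_ee r n h]; push_cast; ring

lemma ccr_ne {lam : Fin d → ℝ} {r s : Fin d} (hrs : r ≠ s) :
    Dn r * Up lam s = Up lam s * Dn r := by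
  ext f n
  simp only [Module.End.mul_apply, 
    Dn, Up, LinearMap.coe_mk, AddHom.coe_mk, Pi.add_apply, sub_add_ee' hrs, ee_ne hrs.symm, add_zero]
  ring

lemma up_comm {lam : Fin d → ℝ} (r s : Fin d) :
    Up lam r * Up lam s = Up lam s * Up lam r := by
  by_cases hrs : r = s
  · rw [hrs]
  ext f n
  simp only [Module.End.mul_apply, 
    Up, LinearMap.coe_mk, AddHom.coe_mk, Pi.sub_apply, ee_ne hrs, ee_ne (Ne.symm hrs), tsub_zero]
  rw [tsub_right_comm]
  ring

/-- Smeared annihilation operator. -/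
def aa (q : Fin d → ℝ) : Module.End ℝ ((Fin d → ℕ) → ℝ) := ∑ r, q r • Dn r
/-- Smeared creation operator. -/
def as (lam : Fin d → ℝ) (q : Fin d → ℝ) : Module.End ℝ ((Fin d → ℕ) → ℝ) := ∑ r, q r • Up lam r
/-- Number operator. -/
def Num (lam : Fin d → ℝ) : Module.End ℝ ((Fin d → ℕ) → ℝ) := ∑ r, lam r • (Up lam r * Dn r)

/-- Weighted squared norm. -/
def nq (lam : Fin d → ℝ) (q : Fin d → ℝ) : ℝ := ∑ r, q r ^ 2 / lam r

variable {lam : Fin d → ℝ} (hlam : ∀ r, 0 < lam r)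
include hlam

lemma ccr_all (r s : Fin d) :
    Dn r * Up lam s = Up lam s * Dn r + (if s = r then (lam r)⁻¹ else 0) • 1 := by
  by_cases h : s = r
  · subst h; simpa using ccr_self hlam s
  · simp [h, ccr_ne (lam := lam) (Ne.symm h)]

lemma ccr_smear (q : Fin d → ℝ) : aa q * as lam q = as lam q * aa q + nq lam q • 1 := by
  simp only [aa, as, Finset.sum_mul_sum, smul_mul_smul_comm, ccr_all hlam, smul_add, 
    Finset.sum_add_distrib, smul_smul]
  congr 1
  · rw [Finset.sum_comm]; simp only [mul_comm]
  · rw [nq, Finset.sum_smul]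
    refine Finset.sum_congr rfl fun r _ => ?_
    rw [← Finset.sum_smul]
    congr 1
    simp
    ring

lemma num_comm (q : Fin d → ℝ) : Num lam * as lam q = as lam q * Num lam + as lam q := by
  have key : ∀ s, Num lam * Up lam s = Up lam s * Num lam + Up lam s := by
    intro s
    have h : ∀ r, lam r • (Up lam r * Dn r) * Up lam s
        = Up lam s * (lam r • (Up lam r * Dn r)) + (if s = r then (1:ℝ) else 0) • Up lam s := by
      intro r
      rw [smul_mul_assoc, mul_assoc, ccr_all hlam, mul_add, smul_add, ← mul_assoc, up_comm r s,
        mul_assoc, mul_smul_comm, mul_smul_comm]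
      congr 1
      by_cases hsr : s = r
      · subst hsr; simp [smul_smul, (hlam s).ne']
      · simp [hsr]
    simp only [Num, Finset.sum_mul, Finset.mul_sum, h, Finset.sum_add_distrib]
    congr 1
    rw [← Finset.sum_smul]; simp
  simp only [as, Finset.mul_sum, Finset.sum_mul, mul_smul_comm, key, smul_add, smul_mul_assoc,
    Finset.sum_add_distrib]

omit hlam in
lemma Good.dn {f : (Fin d → ℕ) → ℝ} (hf : Good f) (r : Fin d) : Good (Dn r f) :=
  (hf.up r).sub hf

omit hlam in
lemma Good.upop {f : (Fin d → ℕ) → ℝ} (hf : Good f) (r : Fin d) : Good (Up lam r f) :=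
  (((good_coord r).mul (good_const (lam r)⁻¹)).mul (hf.down r)).sub hf

omit hlam in
lemma Good.aa {f : (Fin d → ℕ) → ℝ} (hf : Good f) (q : Fin d → ℝ) : Good (aa q f) := by
  have := Good.sum Finset.univ (fun r => (good_const (q r)).mul (hf.dn r))
  refine (congrArg Good ?_).mp this
  funext n; simp [PaperL1.aa]

omit hlam in
lemma Good.as {f : (Fin d → ℕ) → ℝ} (hf : Good f) (q : Fin d → ℝ) : Good (as lam q f) := by
  have := Good.sum Finset.univ (fun r => (good_const (q r)).mul (hf.upop (lam := lam) r))
  refine (congrArg Good ?_).mp this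
  funext n; simp [PaperL1.as]

lemma mecke' {E : Type*} [NormedAddCommGroup E] [NormedSpace ℝ E] (r : Fin d)
    (f : (Fin d → ℕ) → ℝ) (g : (Fin d → ℕ) → E) :
    EE lam (fun n => ((n r : ℝ) / lam r * f (n - ee r)) • g n)
      = EE lam (fun n => f n • g (n + ee r)) := by
  have := mecke hlam r (fun n => f (n - ee r) • g n)
  simpa [smul_smul] using this

lemma up_adj {E : Type*} [NormedAddCommGroup E] [NormedSpace ℝ E] [CompleteSpace E] (r : Fin d)
    {f : (Fin d → ℕ) → ℝ} {g : (Fin d → ℕ) → E} (hf : Good f) (hg : Good g) :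
    EE lam (fun n => Up lam r f n • g n) = EE lam (fun n => f n • (g (n + ee r) - g n)) := by
  have h1 : EE lam (fun n => Up lam r f n • g n)
      = EE lam (fun n => ((n r : ℝ) / lam r * f (n - ee r)) • g n - f n • g n) := by
    simp [Up, sub_smul]
  have hG : Good (fun n : Fin d → ℕ => ((n r : ℝ) / lam r * f (n - ee r)) • g n) :=
    (((good_coord r).mul (good_const (lam r)⁻¹)).mul (hf.down r)).smul hg
  rw [h1, EE_sub hlam hG (hf.smul hg), mecke' hlam, ← EE_sub hlam (hf.smul (hg.up r)) (hf.smul hg)]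
  simp [smul_sub]

lemma as_adj {E : Type*} [NormedAddCommGroup E] [NormedSpace ℝ E] [CompleteSpace E] (q : Fin d → ℝ)
    {f : (Fin d → ℕ) → ℝ} {g : (Fin d → ℕ) → E} (hf : Good f) (hg : Good g) :
    EE lam (fun n => as lam q f n • g n)
      = EE lam (fun n => f n • ∑ r, q r • (g (n + ee r) - g n)) := by
  have h1 : EE lam (fun n => as lam q f n • g n)
      = EE lam (fun n => ∑ r, q r • (Up lam r f n • g n)) := by
    simp [as, Finset.sum_smul, smul_smul]
  have h2 : EE lam (fun n => f n • ∑ r, q r • (g (n + ee r) - g n))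
      = EE lam (fun n => ∑ r, q r • (f n • (g (n + ee r) - g n))) := by
    simp only [Finset.smul_sum, smul_comm (f _)]
  rw [h1, h2, EE_sum hlam _ (fun r => (good_const (q r)).smul ((hf.upop r).smul hg)),
    EE_sum hlam _ (fun r => (good_const (q r)).smul (hf.smul ((hg.up r).sub hg)))]
  refine Finset.sum_congr rfl fun r _ => ?_
  rw [EE_smul, EE_smul, up_adj hlam r hf hg]

lemma as_adj_real (q : Fin d → ℝ) {f g : (Fin d → ℕ) → ℝ} (hf : Good f) (hg : Good g) :
    EE lam (fun n => as lam q f n * g n) = EE lam (fun n => f n * aa q g n) := by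
  have := as_adj hlam q hf hg
  simpa [aa, Dn] using this

lemma EE_num {f : (Fin d → ℕ) → ℝ} (hf : Good f) :
    EE lam (fun n => Num lam f n * f n) = EE lam (fun n => ∑ r, lam r * (Dn r f n) ^ 2) := by
  have h1 : EE lam (fun n => Num lam f n * f n)
      = EE lam (fun n => ∑ r, lam r • (Up lam r (Dn r f) n • f n)) := by
    simp [Num, Finset.sum_mul, mul_assoc]
  have h2 : EE lam (fun n => ∑ r, lam r * (Dn r f n) ^ 2)
      = EE lam (fun n => ∑ r, lam r • (Dn r f n • (f (n + ee r) - f n))) := by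
    simp only [sq, smul_eq_mul]; rfl
  rw [h1, h2, EE_sum hlam _ (fun r => (good_const (lam r)).smul (((hf.dn r).upop r).smul hf)),
    EE_sum hlam _ (fun r => (good_const (lam r)).smul ((hf.dn r).smul ((hf.up r).sub hf)))]
  refine Finset.sum_congr rfl fun r _ => ?_
  rw [EE_smul, EE_smul, up_adj hlam r (hf.dn r) hf]

lemma aa_sq_le (q : Fin d → ℝ) (f : (Fin d → ℕ) → ℝ) (n) :
    (aa q f n) ^ 2 ≤ nq lam q * ∑ r, lam r * (Dn r f n) ^ 2 := by
  have := Finset.sum_mul_sq_le_sq_mul_sq Finset.univ (fun r => q r / √(lam r))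
    (fun r => √(lam r) * Dn r f n)
  have e1 : aa q f n = ∑ r, q r / √(lam r) * (√(lam r) * Dn r f n) := by
    simp only [aa, LinearMap.sum_apply, LinearMap.smul_apply, Finset.sum_apply, Pi.smul_apply,
      smul_eq_mul]
    refine Finset.sum_congr rfl fun r _ => ?_
    have := (Real.sqrt_pos.2 (hlam r)).ne'
    field_simp
  rw [e1]
  refine this.trans (le_of_eq ?_)
  simp only [div_pow, mul_pow, Real.sq_sqrt (hlam _).le, nq]

/-- One-step estimate. -/
lemma as_step (q : Fin d → ℝ) {f : (Fin d → ℕ) → ℝ} (hf : Good f) (m : ℕ)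
    (hN : Num lam f = (m : ℝ) • f) :
    EE lam (fun n => (as lam q f n) ^ 2) ≤ (m + 1) * nq lam q * EE lam (fun n => f n ^ 2) := by
  have hff : Good (fun n => f n ^ 2) := by simpa [sq] using hf.mul hf
  have haa : Good (fun n => aa q f n ^ 2) := by simpa [sq] using (hf.aa q).mul (hf.aa q)
  have h1 : EE lam (fun n => (as lam q f n) ^ 2)
      = EE lam (fun n => f n * aa q (as lam q f) n) := by
    rw [← as_adj_real hlam q hf (hf.as q)]; simp only [sq]
  have h2 : (fun n => f n * aa q (as lam q f) n)
      = fun n => as lam q (aa q f) n * f n + nq lam q • (f n ^ 2) := by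
    have := LinearMap.congr_fun (ccr_smear hlam q) f
    simp only [Module.End.mul_apply, LinearMap.add_apply, LinearMap.smul_apply,
      Module.End.one_apply] at this
    funext n
    rw [this]
    simp; ring
  rw [h1, h2, EE_add hlam (((hf.aa q).as q).mul hf) ((good_const _).smul hff), EE_smul,
    as_adj_real hlam q (hf.aa q) hf]
  have h3 : EE lam (fun n => aa q f n * aa q f n) ≤ nq lam q * (m * EE lam (fun n => f n ^ 2)) := by
    have hs : Good (fun n => ∑ r, lam r * (Dn r f n) ^ 2) :=
      Good.sum _ fun r => (good_const _).mul (by simpa [sq] using (hf.dn r).mul (hf.dn r))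
    have := EE_mono hlam haa ((good_const (nq lam q)).smul hs) (aa_sq_le hlam q f)
    rw [EE_smul, ← EE_num hlam hf, hN] at this
    simp only [sq] at this ⊢
    refine this.trans (le_of_eq ?_)
    rw [smul_eq_mul]
    congr 1
    rw [← smul_eq_mul, ← EE_smul]
    simp [mul_assoc]
  rw [smul_eq_mul]
  linarith

/-- multi-particle states -/
lemma state_props (L : List (Fin d → ℝ)) :
    Good (L.foldr (fun q f => as lam q f) (fun _ => 1)) ∧
    Num lam (L.foldr (fun q f => as lam q f) (fun _ => 1))
      = (L.length : ℝ) • (L.foldr (fun q f => as lam q f) (fun _ => 1)) ∧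
    EE lam (fun n => (L.foldr (fun q f => as lam q f) (fun _ => (1:ℝ)) n) ^ 2)
      ≤ L.length.factorial * (L.map (nq lam)).prod * EE lam (fun _ : Fin d → ℕ => (1:ℝ)) := by
  induction L with
  | nil =>
    refine ⟨good_const _, ?_, by simp⟩
    funext n
    have h0 : ∀ r : Fin d, Dn r (fun _ => (1:ℝ)) = 0 := by
      intro r; funext n; simp [Dn]
    simp [Num, h0]
  | cons q L ih =>
    obtain ⟨h1, h2, h3⟩ := ih
    simp only [List.foldr_cons, List.length_cons, List.map_cons, List.prod_cons]
    set f := L.foldr (fun q f => as lam q f) (fun _ => (1:ℝ)) with hf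
    refine ⟨h1.as q, ?_, ?_⟩
    · have := LinearMap.congr_fun (num_comm hlam q) f
      simp only [Module.End.mul_apply, LinearMap.add_apply, h2, map_smul] at this
      rw [this]; push_cast; rw [add_smul, one_smul]
    · refine (as_step hlam q h1 _ h2).trans ?_
      have hn : 0 ≤ nq lam q := Finset.sum_nonneg fun r _ => by have := hlam r; positivity
      calc _ ≤ (L.length + 1) * nq lam q * (L.length.factorial * (L.map (nq lam)).prod * EE lam (fun _ : Fin d → ℕ => (1:ℝ))) := by
            gcongr
        _ = _ := by rw [Nat.factorial_succ]; push_cast; ring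

end ccr

section banach
variable {d : ℕ} {A : Type*} [NormedCommRing A] [NormedAlgebra ℝ A] [CompleteSpace A] [NormOneClass A]
  {lam : Fin d → ℝ} (hlam : ∀ r, 0 < lam r) (U : Fin d → A) (hU : ∀ r, ‖U r‖ ≤ 1)

include hU in
lemma norm_Un_le (n : Fin d → ℕ) : ‖∏ r, U r ^ n r‖ ≤ 1 := by
  refine (Finset.norm_prod_le _ _).trans (Finset.prod_le_one (fun _ _ => norm_nonneg _) fun r _ => ?_)
  exact (norm_pow_le _ _).trans (pow_le_one₀ (norm_nonneg _) (hU r))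

lemma exp_eq_EE :
    NormedSpace.exp (∑ r, lam r • (U r - 1)) = EE lam (fun n => ∏ r, U r ^ n r) := by
  letI : NormedAlgebra ℚ A := NormedAlgebra.restrictScalars ℚ ℝ A
  rw [NormedSpace.exp_sum]
  have h : ∀ r, NormedSpace.exp (lam r • (U r - 1))
      = ∑' m : ℕ, (Real.exp (-lam r) * (lam r ^ m / m.factorial)) • U r ^ m := by
    intro r
    have : lam r • (U r - 1) = lam r • U r + algebraMap ℝ A (-lam r) := by
      rw [smul_sub, Algebra.algebraMap_eq_smul_one, neg_smul]; ring
    rw [this, NormedSpace.exp_add, ← NormedSpace.algebraMap_exp_comm, ← Real.exp_eq_exp_ℝ,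
      NormedSpace.exp_eq_tsum ℝ, mul_comm, ← Algebra.smul_def, ← tsum_const_smul'']
    refine tsum_congr fun m => ?_
    rw [smul_pow, smul_smul, smul_smul]
    congr 1; ring
  simp only [h]
  rw [← (pi_tsum (fun (r : Fin d) (m : ℕ) => (Real.exp (-lam r) * (lam r ^ m / m.factorial)) • U r ^ m) ?_).2]
  · unfold EE
    refine tsum_congr fun n => ?_
    rw [Finset.prod_smul, poi]
  · intro r
    have := (NormedSpace.norm_expSeries_summable' (𝕂 := ℝ) (lam r • U r)).mul_left (Real.exp (-lam r))
    refine this.congr fun m => ?_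
    rw [smul_pow, smul_smul, ← Real.norm_of_nonneg (Real.exp_pos (-lam r)).le, ← norm_smul, smul_smul]
    rw [Real.norm_of_nonneg (Real.exp_pos (-lam r)).le]
    congr 2; ring

include hlam hU in
lemma prod_eq_EE (L : List (Fin d → ℝ)) :
    (L.map fun q => ∑ r, q r • (U r - 1)).prod * NormedSpace.exp (∑ r, lam r • (U r - 1))
      = EE lam (fun n => (L.foldr (fun q f => as lam q f) (fun _ => (1:ℝ)) n) • ∏ r, U r ^ n r) := by
  induction L with
  | nil => simp [exp_eq_EE U]
  | cons q L ih =>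
    have hg : Good (fun n : Fin d → ℕ => ∏ r, U r ^ n r) := good_of_bdd 1 (norm_Un_le U hU)
    have hf := (state_props hlam L).1
    rw [List.map_cons, List.prod_cons, mul_assoc, ih, List.foldr_cons,
      as_adj hlam q hf hg]
    have hshift : ∀ (n : Fin d → ℕ) r, ∏ s, U s ^ (n + ee r) s = U r * ∏ s, U s ^ n s := by
      intro n r
      have : ∏ s, U s ^ ee r s = U r := by simp [ee, pow_ite]
      simp only [Pi.add_apply, pow_add, Finset.prod_mul_distrib, this, mul_comm]
    simp only [hshift]
    unfold EE
    rw [← (hf.smul hg).summable hlam |>.tsum_mul_left]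
    refine tsum_congr fun n => ?_
    rw [mul_smul_comm, mul_smul_comm, Finset.sum_mul]
    congr 2
    refine Finset.sum_congr rfl fun r _ => ?_
    rw [smul_mul_assoc, sub_mul, one_mul]

omit [CompleteSpace A] in
include hlam in
lemma EE_one : EE lam (fun _ : Fin d → ℕ => (1:ℝ)) = 1 := by
  have := exp_eq_EE (lam := lam) (A := ℝ) (fun _ => 1)
  simpa using this.symm

include hlam hU in
/-- Main smoothness estimate in a Banach algebra. -/
lemma main_bound (L : List (Fin d → ℝ)) :
    ‖(L.map fun q => ∑ r, q r • (U r - 1)).prod * NormedSpace.exp (∑ r, lam r • (U r - 1))‖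
      ≤ √(L.length.factorial) * (L.map fun q => √(nq lam q)).prod := by
  rw [prod_eq_EE hlam U hU]
  obtain ⟨hf, -, h3⟩ := state_props hlam L
  set f := L.foldr (fun q f => as lam q f) (fun _ => (1:ℝ)) with hfdef
  have hg : Good (fun n : Fin d → ℕ => ∏ r, U r ^ n r) := good_of_bdd 1 (norm_Un_le U hU)
  rw [EE_one hlam, mul_one] at h3
  have hsq : √(L.length.factorial) * (L.map fun q => √(nq lam q)).prod
      = √(L.length.factorial * (L.map (nq lam)).prod) := by
    rw [Real.sqrt_mul (by positivity)]
    congr 1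
    clear h3 hf hfdef f
    induction L with
    | nil => simp
    | cons q L ih =>
      have hn : 0 ≤ nq lam q := Finset.sum_nonneg fun r _ => by have := hlam r; positivity
      simp only [List.map_cons, List.prod_cons, ih, Real.sqrt_mul hn]
  rw [hsq]
  refine (EE_norm_le hlam (hf.smul hg)).trans ?_
  have habs : Good (fun n => |f n|) := by simpa [Good] using hf
  have hff : Good (fun n => f n ^ 2) := by simpa [sq] using hf.mul hf
  have hnorm : Good (fun n => ‖f n • ∏ r, U r ^ n r‖) := by simpa [Good] using hf.smul hg
  have h4 : EE lam (fun n => ‖f n • ∏ r, U r ^ n r‖) ≤ EE lam (fun n => |f n|) := by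
    refine EE_mono hlam hnorm habs fun n => ?_
    rw [norm_smul, Real.norm_eq_abs]
    exact mul_le_of_le_one_right (abs_nonneg _) (norm_Un_le U hU n)
  refine h4.trans (Real.le_sqrt_of_sq_le (le_trans ?_ h3))
  -- Cauchy-Schwarz through the variance
  set c := EE lam (fun n => |f n|) with hc
  have h5 : 0 ≤ EE lam (fun n => (f n ^ 2 - (2 * c) • |f n|) + (c ^ 2) • (1:ℝ)) := by
    refine tsum_nonneg fun n => mul_nonneg (poi_nonneg hlam n) ?_
    have := sq_nonneg (|f n| - c)
    have h6 := sq_abs (f n)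
    simp only [smul_eq_mul]
    nlinarith
  rw [EE_add hlam (hff.sub ((good_const _).smul habs)) ((good_const _).smul (good_const _)),
    EE_sub hlam hff ((good_const _).smul habs), EE_smul, EE_smul, EE_one hlam, ← hc] at h5
  simp only [smul_eq_mul] at h5
  nlinarith

end banach
end PaperL1

namespace PaperL1

lemma log_fact_convex (k s t : ℕ) (hk : 1 ≤ k) (hst : s + t ≤ k) :
    (k : ℝ) * Real.log ((2 * s + t).factorial) ≤
      s * Real.log ((2 * k).factorial) + t * Real.log (k.factorial) := by
  have hk0 : (0:ℝ) < k := by exact_mod_cast hk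
  have h := Real.convexOn_log_Gamma.map_sum_le (t := Finset.univ)
    (w := ![(s:ℝ) / k, (t:ℝ)/k, ((k:ℝ) - s - t)/k])
    (p := ![((2 * k : ℕ) : ℝ) + 1, (k : ℝ) + 1, ((0:ℕ):ℝ) + 1]) ?_ ?_ ?_
  · simp only [Fin.sum_univ_three, Function.comp, Matrix.cons_val_zero, Matrix.cons_val_one,
      Matrix.cons_val_two, Matrix.cons_val, Matrix.head_cons, Matrix.tail_cons, smul_eq_mul, Real.Gamma_nat_eq_factorial] at h
    have e : (s:ℝ) / k * (((2 * k : ℕ) : ℝ) + 1) + (t:ℝ)/k * ((k:ℝ) + 1) + ((k:ℝ) - s - t)/k * (((0:ℕ):ℝ) + 1)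
        = ((2 * s + t : ℕ) : ℝ) + 1 := by
      push_cast; field_simp; ring
    rw [e, Real.Gamma_nat_eq_factorial] at h
    simp only [Nat.factorial_zero, Nat.cast_one, Real.log_one, mul_zero, add_zero] at h
    calc _ ≤ (k:ℝ) * ((s:ℝ) / k * Real.log ((2 * k).factorial) + (t:ℝ) / k * Real.log (k.factorial)) := by
          gcongr
      _ = _ := by field_simp
  · have : ((s + t : ℕ) : ℝ) ≤ k := by exact_mod_cast hst
    push_cast at this
    intro i _
    fin_cases i
    · simp; positivity
    · simp; positivity
    · simp; exact div_nonneg (by linarith) hk0.le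
  · simp [Fin.sum_univ_three]; field_simp; ring
  · intro i _
    fin_cases i <;> simp <;> positivity

lemma fact_sq_le (k : ℕ) (hk : 1 ≤ k) : k.factorial ^ 2 ≤ (2 * k - 1).factorial := by
  induction k, hk using Nat.le_induction with
  | base => simp
  | succ n hn ih =>
    have : 2 * (n + 1) - 1 = (2 * n - 1) + 1 + 1 := by omega
    rw [this, Nat.factorial_succ, Nat.factorial_succ, Nat.factorial_succ, mul_pow]
    have h2 : 2 * n - 1 + 1 = 2 * n := by omega
    rw [h2, ← mul_assoc]
    gcongr
    nlinarith

lemma fact_bound (k s t : ℕ) (hk : 1 ≤ k) (hst : s + t ≤ k) :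
    √((2 * s + t).factorial) ≤
      (((2 * k).factorial : ℝ) ^ ((1:ℝ) / (2 * k))) ^ s *
      (((2 * k - 1).factorial : ℝ) ^ ((1:ℝ) / (4 * k))) ^ t := by
  have hk0 : (0:ℝ) < k := by exact_mod_cast hk
  have h1 := log_fact_convex k s t hk hst
  have h2 : 2 * Real.log k.factorial ≤ Real.log ((2 * k - 1).factorial) := by
    rw [← Real.log_rpow (by positivity)]
    apply Real.log_le_log (by positivity)
    have := fact_sq_le k hk
    exact_mod_cast this
  have p1 : (0:ℝ) < ((2 * s + t).factorial : ℝ) := by positivity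
  have p2 : (0:ℝ) < ((2 * k).factorial : ℝ) := by positivity
  have p3 : (0:ℝ) < ((2 * k - 1).factorial : ℝ) := by positivity
  rw [← Real.log_le_log_iff (by positivity) (by positivity), Real.log_sqrt p1.le,
    Real.log_mul (by positivity) (by positivity), Real.log_pow, Real.log_pow, Real.log_rpow p2,
    Real.log_rpow p3]
  have e : (s:ℝ) * (1 / (2 * k) * Real.log (2 * k).factorial) + t * (1 / (4 * k) * Real.log (2 * k - 1).factorial)
    = (s * Real.log (2 * k).factorial + t * (Real.log (2 * k - 1).factorial / 2)) / k / 2 := by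
    field_simp; ring
  rw [e]
  gcongr
  rw [le_div_iff₀ hk0]
  have ht : (0:ℝ) ≤ t := by positivity
  nlinarith

section alg
variable {d : ℕ} {A : Type*} [NormedCommRing A] [NormedAlgebra ℝ A] [CompleteSpace A] [NormOneClass A]
  {lam : Fin d → ℝ} (hlam : ∀ r, 0 < lam r) (U : Fin d → A) (hU : ∀ r, ‖U r‖ ≤ 1)

/-- `y` is a product of an element and of `m` linear factors, with total size at most `c`. -/
def Ord (lam : Fin d → ℝ) (U : Fin d → A) (y : A) (m : ℕ) (c : ℝ) : Prop :=
  ∃ (z : A) (L : List (Fin d → ℝ)), L.length = m ∧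
    y = z * (L.map fun q => ∑ r, q r • (U r - 1)).prod ∧
    ‖z‖ * (L.map fun q => √(nq lam q)).prod ≤ c

lemma listprod_nonneg (L : List (Fin d → ℝ)) : 0 ≤ (L.map fun q => √(nq lam q)).prod := by
  refine List.prod_nonneg ?_
  intro a ha
  obtain ⟨q, -, rfl⟩ := List.mem_map.1 ha
  exact Real.sqrt_nonneg _

lemma Ord.mul {y y' : A} {m m' : ℕ} {c c' : ℝ} (h : Ord lam U y m c) (h' : Ord lam U y' m' c') :
    Ord lam U (y * y') (m + m') (c * c') := by
  obtain ⟨z, L, hL, hy, hc⟩ := h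
  obtain ⟨z', L', hL', hy', hc'⟩ := h'
  refine ⟨z * z', L ++ L', by simp [hL, hL'], ?_, ?_⟩
  · rw [hy, hy', List.map_append, List.prod_append]; ring
  · rw [List.map_append, List.prod_append]
    have n1 := listprod_nonneg (lam := lam) L
    have n2 := listprod_nonneg (lam := lam) L'
    calc _ ≤ (‖z‖ * ‖z'‖) * ((L.map fun q => √(nq lam q)).prod * (L'.map fun q => √(nq lam q)).prod) := by
          gcongr; exact norm_mul_le _ _
      _ = (‖z‖ * (L.map fun q => √(nq lam q)).prod) * (‖z'‖ * (L'.map fun q => √(nq lam q)).prod) := by ring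
      _ ≤ c * c' := mul_le_mul hc hc' (by positivity) (le_trans (by positivity) hc)

lemma Ord.prod {ι : Type*} (s : Finset ι) {y : ι → A} {m : ι → ℕ} {c : ι → ℝ}
    (h : ∀ i, Ord lam U (y i) (m i) (c i)) :
    Ord lam U (∏ i ∈ s, y i) (∑ i ∈ s, m i) (∏ i ∈ s, c i) := by
  induction s using Finset.induction_on with
  | empty => exact ⟨1, [], by simp, by simp, by simp⟩
  | insert a s ha ih =>
    rw [Finset.prod_insert ha, Finset.prod_insert ha, Finset.sum_insert ha]
    exact (h a).mul U ih

include hlam hU in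
lemma Ord.bound {y : A} {m : ℕ} {c : ℝ} (h : Ord lam U y m c) :
    ‖y * NormedSpace.exp (∑ r, lam r • (U r - 1))‖ ≤ √(m.factorial) * c := by
  obtain ⟨z, L, hL, hy, hc⟩ := h
  subst hL
  rw [hy, mul_assoc]
  calc _ ≤ ‖z‖ * (√(L.length.factorial) * (L.map fun q => √(nq lam q)).prod) :=
        (norm_mul_le _ _).trans (mul_le_mul_of_nonneg_left (main_bound hlam U hU L) (norm_nonneg _))
    _ = √(L.length.factorial) * (‖z‖ * (L.map fun q => √(nq lam q)).prod) := by ring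
    _ ≤ _ := by gcongr

include hlam hU in
lemma expand_bound (k : ℕ) (hk : 1 ≤ k) (T : Fin k → Fin 3 → A) (c : Fin k → Fin 3 → ℝ)
    (hc : ∀ j i, 0 ≤ c j i)
    (h : ∀ j i, Ord lam U (T j i) i (c j i)) (ck ck' : ℝ)
    (hck : ck = ((2 * k).factorial : ℝ) ^ ((1:ℝ) / (2 * k)))
    (hck' : ck' = ((2 * k - 1).factorial : ℝ) ^ ((1:ℝ) / (4 * k))) :
    ‖(∏ j, ∑ i, T j i) * NormedSpace.exp (∑ r, lam r • (U r - 1))‖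
      ≤ ∏ j, (c j 0 + ck' * c j 1 + ck * c j 2) := by
  let γ : Fin 3 → ℝ := ![1, ck', ck]
  have e : ∀ j, c j 0 + ck' * c j 1 + ck * c j 2 = ∑ i, γ i * c j i := by
    intro j; simp [Fin.sum_univ_three, γ]
  simp only [e]
  rw [Finset.prod_univ_sum, Finset.prod_univ_sum, Finset.sum_mul]
  refine (norm_sum_le _ _).trans (Finset.sum_le_sum fun f _ => ?_)
  have hb := (Ord.prod U Finset.univ (fun j => h j (f j))).bound hlam U hU
  refine hb.trans ?_
  rw [Finset.prod_mul_distrib]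
  refine mul_le_mul_of_nonneg_right ?_ (Finset.prod_nonneg fun j _ => hc _ _)
  let s := (Finset.univ.filter fun j => f j = 2).card
  let t := (Finset.univ.filter fun j => f j = 1).card
  have hs : ∑ j, ((f j : Fin 3) : ℕ) = 2 * s + t := by
    simp only [s, t, Finset.card_filter, Finset.mul_sum, ← Finset.sum_add_distrib]
    refine Finset.sum_congr rfl fun j _ => ?_
    generalize f j = i
    fin_cases i <;> simp
  have hp : ∏ j, γ (f j) = ck ^ s * ck' ^ t := by
    simp only [s, t, Finset.card_filter, ← Finset.prod_pow_eq_pow_sum, ← Finset.prod_mul_distrib]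
    refine Finset.prod_congr rfl fun j _ => ?_
    generalize f j = i
    fin_cases i <;> simp [γ]
  have hst : s + t ≤ k := by
    have : s + t ≤ ∑ j : Fin k, 1 := by
      simp only [s, t, Finset.card_filter, ← Finset.sum_add_distrib]
      refine Finset.sum_le_sum fun j _ => ?_
      generalize f j = i
      fin_cases i <;> simp
    simpa using this
  rw [hs, hp, hck, hck']
  exact fact_bound k s t hk hst

include hU in
lemma norm_lin_le (q : Fin d → ℝ) : ‖∑ r, q r • (U r - 1)‖ ≤ 2 * ∑ r, |q r| := by
  rw [Finset.mul_sum]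
  refine (norm_sum_le _ _).trans (Finset.sum_le_sum fun r _ => ?_)
  rw [norm_smul, Real.norm_eq_abs, mul_comm]
  have : ‖U r - 1‖ ≤ 2 := (norm_sub_le _ _).trans (by rw [norm_one]; linarith [hU r])
  gcongr

include hlam hU in
theorem abstract_bound (k : ℕ) (hk : 1 ≤ k)
    (p : Fin k → Fin d → ℝ) (pa : Fin k → ℝ) (hpa : ∀ j, pa j = ∑ r, |p j r|)
    (u v w : Fin k → ℝ)
    (hu : ∀ j, u j ∈ Set.Icc (0:ℝ) (1/2)) (hv : ∀ j, 0 < v j) (hw : ∀ j, 0 < w j)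
    (ck ck' : ℝ)
    (hck : ck = ((2 * k).factorial : ℝ) ^ ((1:ℝ) / (2 * k)))
    (hck' : ck' = ((2 * k - 1).factorial : ℝ) ^ ((1:ℝ) / (4 * k)))
    (C : Fin k → ℝ)
    (hC : ∀ j, C j = max (ck + ck' * u j / v j)
      ((2 * (1 - u j) + ck' * u j * v j) * w j)) :
    ‖(∏ j, ((∑ r, p j r • (U r - 1)) * (∑ r, p j r • (U r - 1))))
        * NormedSpace.exp (∑ r, lam r • (U r - 1))‖ ≤
      ∏ j, (C j * ∑ r, |p j r| * min (|p j r| / lam r) (4 / w j * pa j)) := by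
  classical
  let S : Fin k → Fin d → Prop := fun j r => |p j r| / lam r ≤ 4 / w j * pa j
  let pA : Fin k → Fin d → ℝ := fun j r => if S j r then p j r else 0
  let pB : Fin k → Fin d → ℝ := fun j r => if S j r then 0 else p j r
  let RA : Fin k → A := fun j => ∑ r, pA j r • (U r - 1)
  let RB : Fin k → A := fun j => ∑ r, pB j r • (U r - 1)
  let a : Fin k → ℝ := fun j => ∑ r, |pA j r|
  let b : Fin k → ℝ := fun j => ∑ r, |pB j r|
  let α : Fin k → ℝ := fun j => √(nq lam (pA j))
  have ha : ∀ j, 0 ≤ a j := fun j => Finset.sum_nonneg fun r _ => abs_nonneg _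
  have hb : ∀ j, 0 ≤ b j := fun j => Finset.sum_nonneg fun r _ => abs_nonneg _
  have hα : ∀ j, 0 ≤ α j := fun j => Real.sqrt_nonneg _
  have hRAn : ∀ j, ‖RA j‖ ≤ 2 * a j := fun j => norm_lin_le U hU _
  have hRBn : ∀ j, ‖RB j‖ ≤ 2 * b j := fun j => norm_lin_le U hU _
  have hsum : ∀ j, ∑ r, p j r • (U r - 1) = RA j + RB j := by
    intro j
    simp only [RA, RB, ← Finset.sum_add_distrib, ← add_smul]
    refine Finset.sum_congr rfl fun r _ => ?_
    congr 1
    by_cases h : S j r <;> simp [pA, pB, h]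
  have hab : ∀ j, pa j = a j + b j := by
    intro j
    simp only [hpa, a, b, ← Finset.sum_add_distrib]
    refine Finset.sum_congr rfl fun r _ => ?_
    by_cases h : S j r <;> simp [pA, pB, h]
  have hmin : ∀ j, ∑ r, |p j r| * min (|p j r| / lam r) (4 / w j * pa j)
      = α j ^ 2 + 4 / w j * pa j * b j := by
    intro j
    have hn : 0 ≤ nq lam (pA j) := Finset.sum_nonneg fun r _ => by have := hlam r; positivity
    rw [show α j ^ 2 = nq lam (pA j) from Real.sq_sqrt hn]
    simp only [nq, b, Finset.mul_sum, ← Finset.sum_add_distrib]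
    refine Finset.sum_congr rfl fun r _ => ?_
    by_cases h : S j r
    · rw [min_eq_left h]
      simp only [pA, pB, h, if_true, abs_zero, mul_zero, add_zero]
      rw [← sq_abs]; ring
    · rw [min_eq_right (not_le.1 h).le]
      simp [pA, pB, h]; ring
  let T : Fin k → Fin 3 → A := fun j =>
    ![((2 * (1 - u j)) • RA j + RB j) * RB j, (2 * u j) • (RB j * RA j), RA j * RA j]
  let c : Fin k → Fin 3 → ℝ := fun j =>
    ![8 * (1 - u j) * b j * (a j + b j), 4 * u j * b j * α j, α j ^ 2]
  have hT : ∀ j, (∑ r, p j r • (U r - 1)) * (∑ r, p j r • (U r - 1)) = ∑ i : Fin 3, T j i := by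
    intro j
    rw [hsum]
    simp only [T, Fin.sum_univ_three, Matrix.cons_val_zero, Matrix.cons_val_one, Matrix.cons_val]
    simp only [Algebra.smul_def, map_mul, map_sub, map_one, map_ofNat]
    ring
  have hc : ∀ j i, 0 ≤ c j i := by
    intro j i
    have := ha j; have := hb j; have := hα j; have := (hu j).1
    have : 0 ≤ 1 - u j := by linarith [(hu j).2]
    fin_cases i <;> simp [c] <;> positivity
  have hO : ∀ j i, Ord lam U (T j i) i (c j i) := by
    intro j i
    have h1 := ha j
    have h2 := hb j
    have h3 := hα j
    have h4 := (hu j).1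
    have h5 : 0 ≤ 1 - u j := by linarith [(hu j).2]
    fin_cases i
    · refine ⟨T j 0, [], rfl, by simp, ?_⟩
      simp only [List.map_nil, List.prod_nil, mul_one]
      change ‖((2 * (1 - u j)) • RA j + RB j) * RB j‖ ≤ 8 * (1 - u j) * b j * (a j + b j)
      have e1 : ‖(2 * (1 - u j)) • RA j + RB j‖ ≤ 4 * (1 - u j) * (a j + b j) := by
        refine (norm_add_le _ _).trans ?_
        rw [norm_smul, Real.norm_of_nonneg (by positivity)]
        have := mul_le_mul_of_nonneg_left (hRAn j) (by positivity : 0 ≤ 2 * (1 - u j))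
        have h6 := hRBn j
        have h7 : 0 ≤ (1 - 2 * u j) * b j := mul_nonneg (by linarith [(hu j).2]) h2
        nlinarith
      calc _ ≤ (4 * (1 - u j) * (a j + b j)) * (2 * b j) :=
            (norm_mul_le _ _).trans (mul_le_mul e1 (hRBn j) (norm_nonneg _) (by positivity))
        _ = _ := by ring
    · refine ⟨(2 * u j) • RB j, [pA j], rfl, ?_, ?_⟩
      · simp only [List.map_cons, List.map_nil, List.prod_cons, List.prod_nil, mul_one]
        change (2 * u j) • (RB j * RA j) = (2 * u j) • RB j * RA j
        rw [smul_mul_assoc]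
      · simp only [List.map_cons, List.map_nil, List.prod_cons, List.prod_nil, mul_one]
        change ‖(2 * u j) • RB j‖ * α j ≤ 4 * u j * b j * α j
        rw [norm_smul, Real.norm_of_nonneg (by positivity)]
        refine mul_le_mul_of_nonneg_right ?_ h3
        have := mul_le_mul_of_nonneg_left (hRBn j) (by positivity : 0 ≤ 2 * u j)
        linarith
    · refine ⟨1, [pA j, pA j], rfl, ?_, ?_⟩
      · simp only [List.map_cons, List.map_nil, List.prod_cons, List.prod_nil, mul_one, one_mul]
        rfl
      · simp only [List.map_cons, List.map_nil, List.prod_cons, List.prod_nil, mul_one, one_mul,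
          norm_one]
        change α j * α j ≤ α j ^ 2
        rw [sq]
  have hfin := expand_bound hlam U hU k hk T c hc hO ck ck' hck hck'
  simp only [hT, hmin]
  refine hfin.trans (Finset.prod_le_prod ?_ ?_)
  · intro j _
    have := hc j 0; have := hc j 1; have := hc j 2
    have : 0 ≤ ck := by rw [hck]; positivity
    have : 0 ≤ ck' := by rw [hck']; positivity
    positivity
  · intro j _
    change 8 * (1 - u j) * b j * (a j + b j) + ck' * (4 * u j * b j * α j) + ck * α j ^ 2 ≤ _
    have h1 := ha j
    have h2 := hb j
    have h3 := hα j
    have h4 := (hu j).1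
    have h5 : 0 ≤ 1 - u j := by linarith [(hu j).2]
    have hwj := hw j
    have hvj := hv j
    have k1 : 0 ≤ ck' := by rw [hck']; positivity
    have c1 : ck + ck' * u j / v j ≤ C j := by rw [hC]; exact le_max_left _ _
    have c2 : (2 * (1 - u j) + ck' * u j * v j) * w j ≤ C j := by rw [hC]; exact le_max_right _ _
    rw [hab j]
    have amgm : 4 * b j * α j ≤ α j ^ 2 / v j + 4 * b j ^ 2 * v j := by
      have : 0 ≤ (α j - 2 * b j * v j) ^ 2 / v j := by positivity
      have e : (α j - 2 * b j * v j) ^ 2 / v j = α j ^ 2 / v j + 4 * b j ^ 2 * v j - 4 * b j * α j := by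
        field_simp; ring
      linarith
    have hX : 0 ≤ 4 / w j * (a j + b j) * b j := by positivity
    have m1 := mul_le_mul_of_nonneg_right c1 (sq_nonneg (α j))
    have m2 := mul_le_mul_of_nonneg_right c2 hX
    have e2 : (2 * (1 - u j) + ck' * u j * v j) * w j * (4 / w j * (a j + b j) * b j)
        = 8 * (1 - u j) * b j * (a j + b j) + ck' * u j * (4 * b j ^ 2 * v j) + ck' * u j * (4 * a j * b j * v j) := by
      field_simp; ring
    have e3 : (ck + ck' * u j / v j) * α j ^ 2 = ck * α j ^ 2 + ck' * u j * (α j ^ 2 / v j) := by ring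
    have m3 := mul_le_mul_of_nonneg_left amgm (by positivity : 0 ≤ ck' * u j)
    have m4 : 0 ≤ ck' * u j * (4 * a j * b j * v j) := by positivity
    rw [e2] at m2
    rw [e3] at m1
    rw [mul_add]
    linarith

end alg
end PaperL1

namespace PaperL1

section l1
variable {X : Type*} [AddCommMonoid X]

lemma prod_summable {f g : X → ℝ} (hf : Summable fun x => |f x|) (hg : Summable fun x => |g x|) :
    Summable fun q : X × X => |f q.1 * g q.2| := by
  simp only [← Real.norm_eq_abs] at hf hg ⊢
  exact Summable.mul_norm (f := f) (g := g) hf hg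

lemma fiber_summable {f g : X → ℝ} (hf : Summable fun x => |f x|) (hg : Summable fun x => |g x|)
    (x : X) : Summable fun p : {p : X × X // p.1 + p.2 = x} => f p.1.1 * g p.1.2 := by
  have h : Summable fun q : X × X => f q.1 * g q.2 := (prod_summable hf hg).of_abs
  exact h.subtype {p : X × X | p.1 + p.2 = x}

lemma conv_summable {f g : X → ℝ} (hf : Summable fun x => |f x|) (hg : Summable fun x => |g x|) :
    (Summable fun x => |conv f g x|) ∧
      ∑' x, |conv f g x| ≤ (∑' x, |f x|) * ∑' x, |g x| := by
  have hs := prod_summable hf hg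
  have hs' := (Equiv.sigmaFiberEquiv (fun p : X × X => p.1 + p.2)).summable_iff.2 hs
  have hle : ∀ x, |conv f g x| ≤ ∑' p : {p : X × X // p.1 + p.2 = x}, |f p.1.1 * g p.1.2| := by
    intro x
    have : Summable fun p : {p : X × X // p.1 + p.2 = x} => ‖f p.1.1 * g p.1.2‖ := by
      simp only [Real.norm_eq_abs]
      exact hs.subtype {p : X × X | p.1 + p.2 = x}
    have h2 := norm_tsum_le_tsum_norm this
    simp only [Real.norm_eq_abs] at h2
    exact h2
  have hsx := hs'.sigma
  have h1 : Summable fun x => |conv f g x| :=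
    Summable.of_nonneg_of_le (fun _ => abs_nonneg _) hle hsx
  refine ⟨h1, (h1.tsum_le_tsum hle hsx).trans (le_of_eq ?_)⟩
  have e1 := hs'.tsum_sigma
  have e2 := (Equiv.sigmaFiberEquiv (fun p : X × X => p.1 + p.2)).tsum_eq
    (fun q : X × X => |f q.1 * g q.2|)
  have e3 : (∑' x, |f x|) * ∑' x, |g x| = ∑' z : X × X, |f z.1| * |g z.2| :=
    tsum_mul_tsum_of_summable_norm (by simpa using hf) (by simpa using hg)
  rw [e3]
  simp only [← abs_mul]
  rw [← e2]
  exact e1.symm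

lemma mul_bdd_summable {f φ : X → ℝ} (hf : Summable fun x => |f x|) {B : ℝ} (hφ : ∀ x, |φ x| ≤ B) :
    Summable fun x => |f x * φ x| := by
  refine Summable.of_nonneg_of_le (fun _ => abs_nonneg _) (fun x => ?_) (hf.mul_right B)
  rw [abs_mul]
  exact mul_le_mul_of_nonneg_left (hφ x) (abs_nonneg _)

lemma conv_test {f g φ : X → ℝ} (hf : Summable fun x => |f x|) (hg : Summable fun x => |g x|)
    {B : ℝ} (hφ : ∀ x, |φ x| ≤ B) :
    ∑' x, conv f g x * φ x = ∑' y, f y * ∑' z, g z * φ (y + z) := by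
  have hs : Summable fun q : X × X => f q.1 * g q.2 * φ (q.1 + q.2) := by
    refine Summable.of_norm_bounded ((prod_summable hf hg).mul_right B) fun q => ?_
    rw [Real.norm_eq_abs, abs_mul]
    exact mul_le_mul_of_nonneg_left (hφ _) (abs_nonneg _)
  have hs' := (Equiv.sigmaFiberEquiv (fun p : X × X => p.1 + p.2)).summable_iff.2 hs
  have e1 := hs'.tsum_sigma
  have e2 := (Equiv.sigmaFiberEquiv (fun p : X × X => p.1 + p.2)).tsum_eq
    (fun q : X × X => f q.1 * g q.2 * φ (q.1 + q.2))
  have e3 := hs.tsum_prod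
  calc ∑' x, conv f g x * φ x
      = ∑' x, ∑' p : {p : X × X // p.1 + p.2 = x}, f p.1.1 * g p.1.2 * φ (p.1.1 + p.1.2) := by
        refine tsum_congr fun x => ?_
        rw [conv, ← tsum_mul_right]
        refine tsum_congr fun p => ?_
        rw [p.2]
    _ = ∑' q : X × X, f q.1 * g q.2 * φ (q.1 + q.2) := by rw [← e2]; exact e1.symm
    _ = _ := by
        rw [e3]
        refine tsum_congr fun y => ?_
        rw [← tsum_mul_left]
        refine tsum_congr fun z => ?_
        ring

lemma delta_bdd (x y : X) : |delta x y| ≤ 1 := by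
  unfold delta; split_ifs <;> simp

lemma test_delta (f : X → ℝ) (x : X) : ∑' y, f y * delta x y = f x := by
  rw [tsum_eq_single x]
  · simp [delta]
  · intro y hy; simp [delta, hy]

lemma delta_summable (x : X) : Summable fun y => |delta x y| := by
  refine summable_of_ne_finset_zero (s := {x}) ?_
  intro y hy
  have : y ≠ x := by simpa using hy
  simp [delta, this]

lemma conv_assoc {f g h : X → ℝ} (hf : Summable fun x => |f x|) (hg : Summable fun x => |g x|)
    (hh : Summable fun x => |h x|) : conv (conv f g) h = conv f (conv g h) := by
  funext x
  rw [← test_delta (conv (conv f g) h) x, ← test_delta (conv f (conv g h)) x,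
    conv_test (conv_summable hf hg).1 hh (delta_bdd x),
    conv_test hf (conv_summable hg hh).1 (delta_bdd x)]
  have hψ : ∀ y, |∑' z, h z * delta x (y + z)| ≤ ∑' z, |h z| := by
    intro y
    have hs := mul_bdd_summable (φ := fun z => delta x (y + z)) hh (fun z => delta_bdd x (y + z))
    have : |∑' z, h z * delta x (y + z)| ≤ ∑' z, |h z * delta x (y + z)| := by
      simp only [← Real.norm_eq_abs] at hs ⊢
      exact norm_tsum_le_tsum_norm hs
    refine this.trans (hs.tsum_le_tsum (fun z => ?_) hh)
    rw [abs_mul]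
    exact mul_le_of_le_one_right (abs_nonneg _) (delta_bdd _ _)
  rw [conv_test hf hg hψ]
  refine tsum_congr fun a => ?_
  rw [conv_test hg hh (φ := fun s => delta x (a + s)) (fun s => delta_bdd x (a + s))]
  simp only [add_assoc]

lemma conv_comm (f g : X → ℝ) : conv f g = conv g f := by
  funext x
  let e : {p : X × X // p.1 + p.2 = x} ≃ {p : X × X // p.1 + p.2 = x} :=
    { toFun := fun p => ⟨(p.1.2, p.1.1), by rw [add_comm]; exact p.2⟩
      invFun := fun p => ⟨(p.1.2, p.1.1), by rw [add_comm]; exact p.2⟩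
      left_inv := fun p => rfl
      right_inv := fun p => rfl }
  unfold conv
  rw [← e.tsum_eq]
  refine tsum_congr fun p => ?_
  simp only [e, Equiv.coe_fn_mk]
  ring

lemma delta_conv {f : X → ℝ} (hf : Summable fun x => |f x|) : conv (delta 0) f = f := by
  funext x
  rw [← test_delta (conv (delta 0) f) x, conv_test (delta_summable 0) hf (delta_bdd x),
    tsum_eq_single 0]
  · simp [delta, test_delta]
  · intro y hy; simp [delta, hy]

lemma conv_add {f g h : X → ℝ} (hf : Summable fun x => |f x|) (hg : Summable fun x => |g x|)
    (hh : Summable fun x => |h x|) : conv f (g + h) = conv f g + conv f h := by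
  funext x
  simp only [conv, Pi.add_apply, mul_add]
  exact (fiber_summable hf hg x).tsum_add (fiber_summable hf hh x)

lemma conv_smul (c : ℝ) (f g : X → ℝ) : conv (c • f) g = c • conv f g := by
  funext x
  simp only [conv, Pi.smul_apply, smul_eq_mul, mul_assoc, tsum_mul_left]

/-- The convolution algebra. -/
def L1 (X : Type*) := lp (fun _ : X => ℝ) 1

instance : NormedAddCommGroup (L1 X) := inferInstanceAs (NormedAddCommGroup (lp (fun _ : X => ℝ) 1))
instance : NormedSpace ℝ (L1 X) := inferInstanceAs (NormedSpace ℝ (lp (fun _ : X => ℝ) 1))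
instance : CompleteSpace (L1 X) := inferInstanceAs (CompleteSpace (lp (fun _ : X => ℝ) 1))

/-- Underlying function. -/
def fn (f : L1 X) : X → ℝ := fun x => f.1 x

lemma fn_ext {f g : L1 X} (h : fn f = fn g) : f = g := Subtype.ext h

lemma fn_summable (f : L1 X) : Summable fun x => |fn f x| := by
  have := (memℓp_gen_iff (p := 1) (by simp)).1 f.2
  simp only [ENNReal.toReal_one, Real.rpow_one, Real.norm_eq_abs] at this
  exact this

/-- Build an element. -/
def ofFn (f : X → ℝ) (h : Summable fun x => |f x|) : L1 X :=
  ⟨f, (memℓp_gen_iff (p := 1) (by simp)).2 (by simpa using h)⟩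

lemma fn_ofFn (f : X → ℝ) (h : Summable fun x => |f x|) : fn (ofFn f h) = f := rfl

lemma norm_fn (f : L1 X) : ‖f‖ = l1norm (fn f) := by
  have := lp.norm_eq_tsum_rpow (p := 1) (by simp) (f : lp (fun _ : X => ℝ) 1)
  simp only [ENNReal.toReal_one, Real.rpow_one, div_one] at this
  exact this

lemma fn_add (f g : L1 X) : fn (f + g) = fn f + fn g := rfl
lemma fn_sub (f g : L1 X) : fn (f - g) = fn f - fn g := rfl
lemma fn_smul (c : ℝ) (f : L1 X) : fn (c • f) = c • fn f := rfl

instance : Mul (L1 X) :=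
  ⟨fun f g => ofFn (conv (fn f) (fn g)) (conv_summable (fn_summable f) (fn_summable g)).1⟩
instance : One (L1 X) := ⟨ofFn (delta 0) (delta_summable 0)⟩

lemma fn_mul (f g : L1 X) : fn (f * g) = conv (fn f) (fn g) := rfl
lemma fn_one : fn (1 : L1 X) = delta 0 := rfl

lemma L1_mul_comm (f g : L1 X) : f * g = g * f := fn_ext (by rw [fn_mul, fn_mul, conv_comm])
lemma L1_mul_add (f g h : L1 X) : f * (g + h) = f * g + f * h := fn_ext (by
  simp only [fn_mul, fn_add]
  exact conv_add (fn_summable f) (fn_summable g) (fn_summable h))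
lemma L1_one_mul (f : L1 X) : 1 * f = f := fn_ext (by
  rw [fn_mul, fn_one, delta_conv (fn_summable f)])
lemma L1_zero_mul (f : L1 X) : 0 * f = 0 := by
  have := L1_mul_add f 0 0
  rw [add_zero] at this
  rw [L1_mul_comm]
  simpa using this

instance : NormedCommRing (L1 X) where
  __ := (inferInstance : NormedAddCommGroup (L1 X))
  left_distrib := L1_mul_add
  right_distrib f g h := by rw [L1_mul_comm, L1_mul_add, L1_mul_comm h, L1_mul_comm h]
  zero_mul := L1_zero_mul
  mul_zero f := by rw [L1_mul_comm, L1_zero_mul]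
  mul_assoc f g h := fn_ext (by
    simp only [fn_mul]
    exact conv_assoc (fn_summable f) (fn_summable g) (fn_summable h))
  one_mul := L1_one_mul
  mul_one f := by rw [L1_mul_comm, L1_one_mul]
  mul_comm := L1_mul_comm
  norm_mul_le f g := by
    rw [norm_fn, norm_fn, norm_fn]
    exact (conv_summable (fn_summable f) (fn_summable g)).2

lemma L1_smul_mul (c : ℝ) (f g : L1 X) : (c • f) * g = c • (f * g) := fn_ext (by
  simp only [fn_mul, fn_smul, conv_smul])

instance : Algebra ℝ (L1 X) := Algebra.ofModule L1_smul_mul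
  (fun c f g => by rw [mul_comm, L1_smul_mul, mul_comm])

instance : NormedAlgebra ℝ (L1 X) where
  norm_smul_le c f := (norm_smul c f).le

instance : NormOneClass (L1 X) where
  norm_one := by
    rw [norm_fn, fn_one, l1norm, tsum_eq_single 0]
    · simp [delta]
    · intro y hy; simp [delta, hy]

/-- Evaluation functional. -/
def ev (x : X) : L1 X →L[ℝ] ℝ :=
  LinearMap.mkContinuous
    { toFun := fun f => fn f x
      map_add' := fun _ _ => rfl
      map_smul' := fun _ _ => rfl } 1 (fun f => by
        rw [one_mul, norm_fn]
        exact (fn_summable f).le_tsum x (fun _ _ => abs_nonneg _))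

lemma ev_apply (x : X) (f : L1 X) : ev x f = fn f x := rfl

lemma fn_sum {ι : Type*} (s : Finset ι) (f : ι → L1 X) : fn (∑ i ∈ s, f i) = ∑ i ∈ s, fn (f i) := by
  funext x
  rw [← ev_apply, map_sum, Finset.sum_apply]
  rfl

lemma fn_pow (f : L1 X) (m : ℕ) : fn (f ^ m) = convPow (fn f) m := by
  induction m with
  | zero => rw [pow_zero, fn_one, convPow]
  | succ m ih => rw [pow_succ', fn_mul, ih, convPow]

lemma fn_exp (f : L1 X) : fn (NormedSpace.exp f) = convExp (fn f) := by
  funext x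
  have h := NormedSpace.exp_series_hasSum_exp' (𝕂 := ℝ) f
  have h2 := (ev x).hasSum h
  rw [← ev_apply, ← h2.tsum_eq, convExp]
  refine tsum_congr fun m => ?_
  simp only [map_smul, ev_apply, fn_pow, smul_eq_mul]

lemma fn_prod {k : ℕ} (F : Fin k → L1 X) :
    fn (∏ j, F j) = convProd Finset.univ (fun j => fn (F j)) := by
  have h1 : ∀ l : List (Fin k), fn ((l.map F).prod)
      = l.foldr (fun i acc => conv (fn (F i)) acc) (delta 0) := by
    intro l
    induction l with
    | nil => rfl
    | cons a l ih => rw [List.map_cons, List.prod_cons, fn_mul, ih, List.foldr_cons]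
  rw [convProd, ← h1]
  congr 1
  rw [Finset.prod, ← Finset.sort_eq Finset.univ (· ≤ ·), Multiset.map_coe, Multiset.prod_coe]

end l1
end PaperL1


/-- Lemma 4.3 of Roos (general form): with `c_k = ((2k)!)^{1/(2k)}`,
`c_k'\ = ((2k-1)!)^{1/(4k)}`, for all `u ∈ [0,1/2]^k`, `v,w ∈ (0,∞)^k`,
`‖(Π_j R_j²) G‖ ≤ Π_j (C_j Σ_r |p_{j,r}| min{|p_{j,r}|/λ_r, (4/w_j) p_j})`
where `C_j = max{c_k + c_k' u_j/v_j, (2(1-u_j) + c_k' u_j v_j) w_j}`. -/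
theorem smoothness_estimate_squares_general
    {X : Type*} [AddCommMonoid X] [Countable X]
    (d k : ℕ) (hd : 1 ≤ d) (hk : 1 ≤ k)
    (p : Fin k → Fin d → ℝ) (lam : Fin d → ℝ) (hlam : ∀ r, 0 < lam r)
    (U : Fin d → X → ℝ) (hU : ∀ r, IsPmf (U r))
    (W : Fin d → X → ℝ) (hW : ∀ r, W r = U r - delta 0)
    (R : Fin k → X → ℝ) (hR : ∀ j, R j = ∑ r, p j r • W r)
    (G : X → ℝ) (hG : G = convExp (∑ r, lam r • W r))
    (pa : Fin k → ℝ) (hpa : ∀ j, pa j = ∑ r, |p j r|)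
    (u v w : Fin k → ℝ)
    (hu : ∀ j, u j ∈ Set.Icc (0:ℝ) (1/2)) (hv : ∀ j, 0 < v j) (hw : ∀ j, 0 < w j)
    (ck ck' : ℝ)
    (hck : ck = ((2 * k).factorial : ℝ) ^ ((1:ℝ) / (2 * k)))
    (hck' : ck' = ((2 * k - 1).factorial : ℝ) ^ ((1:ℝ) / (4 * k)))
    (C : Fin k → ℝ)
    (hC : ∀ j, C j = max (ck + ck' * u j / v j)
      ((2 * (1 - u j) + ck' * u j * v j) * w j)) :
    l1norm (conv (convProd Finset.univ (fun j => conv (R j) (R j))) G) ≤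
      ∏ j, (C j * ∑ r, |p j r| * min (|p j r| / lam r) (4 / w j * pa j)) := by
  have hUs : ∀ r, Summable fun x => |U r x| := fun r => by
    simpa [abs_of_nonneg ((hU r).1 _)] using (hU r).2.summable
  let V : Fin d → L1 X := fun r => ofFn (U r) (hUs r)
  have hV : ∀ r, ‖V r‖ ≤ 1 := by
    intro r
    rw [norm_fn, l1norm]
    have : (fun x => |fn (V r) x|) = U r := by
      funext x; exact abs_of_nonneg ((hU r).1 x)
    rw [this, (hU r).2.tsum_eq]
  have hWf : ∀ r, fn (V r - 1) = W r := by
    intro r; rw [hW, fn_sub, fn_one]; rfl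
  have hRf : ∀ j, fn (∑ r, p j r • (V r - 1)) = R j := by
    intro j; rw [hR, fn_sum]; simp only [fn_smul, hWf]
  have hGf : fn (NormedSpace.exp (∑ r, lam r • (V r - 1))) = G := by
    rw [hG, fn_exp, fn_sum]; simp only [fn_smul, hWf]
  have key := abstract_bound hlam V hV k hk p pa hpa u v w hu hv hw ck ck' hck hck' C hC
  rw [norm_fn, fn_mul, hGf, fn_prod] at key
  simpa only [fn_mul, hRf] using key
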